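/- Fix nonnegative reals λ₁ ≤ λ₂ ≤ … ≤ λ_p and, for each ρ > 0, let γ⋆(ρ) be the unique positive solution of (ρ² − ½·Σᵢ λᵢ)·γ − p + ½·Σᵢ √(λᵢ²γ² + 4λᵢγ) = 0 and define xᵢ(ρ) := γ⋆(ρ)·[ 1 − ½·( √(λᵢ²γ⋆(ρ)² + 4λᵢγ⋆(ρ)) − λᵢγ⋆(ρ) ) ]. Then for every ρ > 0 one has x₁(ρ) ≥ x₂(ρ) ≥ … ≥ x_p(ρ) > 0; moreover, the condition number x₁(ρ)/x_p(ρ) is a decreasing function of ρ on (0, ∞) and x₁(ρ)/x_p(ρ) → 1 as ρ → ∞. -/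

import Mathlib

/-- The shrunk eigenvalue
`x(λ, γ) = γ [ 1 − ½ ( √(λ²γ² + 4λγ) − λγ ) ]`. -/
noncomputable def shrunkEig (lam γ : ℝ) : ℝ :=
  γ * (1 - (Real.sqrt (lam ^ 2 * γ ^ 2 + 4 * lam * γ) - lam * γ) / 2)

/-- The factor `φ(t) = 1 - ½ (√(t² + 4t) - t)`, evaluated at `t = λγ`, equals
`exp (-2 arsinh (½ √λ √γ))`. -/
theorem shrunkEig_eq_mul_exp_arsinh {l g : ℝ} (hl : 0 ≤ l) (hg : 0 ≤ g) :
    shrunkEig l g = g * Real.exp (-(2 * Real.arsinh (√l / 2 * √g))) := by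
  set w := √l / 2 * √g with hw
  have hw0 : 0 ≤ w := by positivity
  have hw2 : w ^ 2 = l * g / 4 := by
    rw [hw, mul_pow, div_pow, Real.sq_sqrt hl, Real.sq_sqrt hg]; ring
  set r := √(1 + w ^ 2) with hr
  have hr2 : r ^ 2 = 1 + w ^ 2 := Real.sq_sqrt (by positivity)
  have hr0 : 0 < r := Real.sqrt_pos.2 (by positivity)
  have hs : √(l ^ 2 * g ^ 2 + 4 * l * g) = 4 * (w * r) := by
    rw [show l ^ 2 * g ^ 2 + 4 * l * g = (4 * (w * r)) ^ 2 by
      rw [mul_pow, mul_pow, hr2, hw2]; ring]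
    exact Real.sqrt_sq (by positivity)
  have he : Real.exp (2 * Real.arsinh w) = (w + r) ^ 2 := by
    rw [two_mul, Real.exp_add, Real.exp_arsinh, ← hr, ← sq]
  have hlg4 : l * g = 4 * w ^ 2 := by linarith
  rw [shrunkEig, hs, Real.exp_neg, he, hlg4]
  congr 1
  refine eq_inv_of_mul_eq_one_left ?_
  have h1 : 1 - (4 * (w * r) - 4 * w ^ 2) / 2 = (r - w) ^ 2 := by linear_combination -hr2
  rw [h1, ← mul_pow, show (r - w) * (w + r) = 1 by linear_combination hr2, one_pow]

theorem monotone_arsinh_mul_sub_arsinh_mul {a b : ℝ} (ha : 0 ≤ a) (hab : a ≤ b) :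
    Monotone fun c : ℝ => Real.arsinh (b * c) - Real.arsinh (a * c) := by
  have hd (k c : ℝ) : HasDerivAt (fun c : ℝ => Real.arsinh (k * c))
      ((√(1 + (k * c) ^ 2))⁻¹ * k) c := by
    simpa using ((hasDerivAt_id c).const_mul k).arsinh
  refine monotone_of_hasDerivAt_nonneg (fun c => (hd b c).sub (hd a c)) fun c => ?_
  have hpos (k : ℝ) : 0 < √(1 + (k * c) ^ 2) := Real.sqrt_pos.2 (by positivity)
  have hb : 0 ≤ b := ha.trans hab
  have hsq : a ^ 2 ≤ b ^ 2 := by gcongr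
  change 0 ≤ _ - _
  rw [sub_nonneg, inv_mul_eq_div, inv_mul_eq_div, div_le_div_iff₀ (hpos a) (hpos b)]
  refine (sq_le_sq₀ (by positivity) (by positivity)).1 ?_
  rw [mul_pow a √_, mul_pow b √_, Real.sq_sqrt (by positivity), Real.sq_sqrt (by positivity)]
  linarith

theorem shrunkEig_pos {l g : ℝ} (hl : 0 ≤ l) (hg : 0 < g) : 0 < shrunkEig l g := by
  rw [shrunkEig_eq_mul_exp_arsinh hl hg.le]
  positivity

theorem shrunkEig_le_shrunkEig {a b g : ℝ} (ha : 0 ≤ a) (hab : a ≤ b) (hg : 0 ≤ g) :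
    shrunkEig b g ≤ shrunkEig a g := by
  rw [shrunkEig_eq_mul_exp_arsinh ha hg, shrunkEig_eq_mul_exp_arsinh (ha.trans hab) hg]
  have : Real.arsinh (√a / 2 * √g) ≤ Real.arsinh (√b / 2 * √g) :=
    Real.arsinh_le_arsinh.2 (by gcongr)
  gcongr

/-- `g ↦ x(λ, g) / g` is decreasing, in cross-multiplied form. -/
theorem mul_shrunkEig_le_mul_shrunkEig {l g g' : ℝ} (hl : 0 ≤ l) (hg : 0 ≤ g) (hgg : g ≤ g') :
    g * shrunkEig l g' ≤ g' * shrunkEig l g := by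
  have hg' : 0 ≤ g' := hg.trans hgg
  rw [shrunkEig_eq_mul_exp_arsinh hl hg, shrunkEig_eq_mul_exp_arsinh hl hg',
    mul_left_comm g' g]
  have : Real.arsinh (√l / 2 * √g) ≤ Real.arsinh (√l / 2 * √g') :=
    Real.arsinh_le_arsinh.2 (by gcongr)
  gcongr

theorem shrunkEig_div_shrunkEig {a b g : ℝ} (ha : 0 ≤ a) (hb : 0 ≤ b) (hg : 0 < g) :
    shrunkEig a g / shrunkEig b g =
      Real.exp (2 * (Real.arsinh (√b / 2 * √g) - Real.arsinh (√a / 2 * √g))) := by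
  rw [shrunkEig_eq_mul_exp_arsinh ha hg.le, shrunkEig_eq_mul_exp_arsinh hb hg.le,
    mul_div_mul_left _ _ hg.ne', ← Real.exp_sub]
  ring_nf

theorem sq_mul_sq_eq_sum_shrunkEig {p : ℕ} {lam : Fin p → ℝ} {ρ g : ℝ}
    (h : (ρ ^ 2 - (∑ i, lam i) / 2) * g - p
      + (∑ i, √((lam i) ^ 2 * g ^ 2 + 4 * lam i * g)) / 2 = 0) :
    ρ ^ 2 * g ^ 2 = ∑ i, shrunkEig (lam i) g := by
  simp only [shrunkEig, ← Finset.mul_sum, Finset.sum_sub_distrib, ← Finset.sum_div,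
    ← Finset.sum_mul]
  simp only [Finset.sum_const, Finset.card_univ, Fintype.card_fin, nsmul_eq_mul, mul_one]
  linear_combination g * h

/-- With `λ₁ ≤ … ≤ λ_p` nonnegative, `γ⋆(ρ)` the unique
positive solution of `(ρ² − ½ Σ λᵢ) γ − p + ½ Σ √(λᵢ²γ² + 4λᵢγ) = 0` and
`xᵢ(ρ) = γ⋆(ρ)[1 − ½(√(λᵢ²γ⋆(ρ)² + 4λᵢγ⋆(ρ)) − λᵢγ⋆(ρ))]`: for each `ρ > 0`
the eigenvalues satisfy `x₁(ρ) ≥ … ≥ x_p(ρ) > 0`; the condition number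
`x₁(ρ)/x_p(ρ)` is a decreasing function of `ρ` on `(0, ∞)` and tends to `1`
as `ρ → ∞`. -/
theorem shrunk_eigenvalue_order_and_condition_number
    {p : ℕ} (hp : 0 < p)
    (lam : Fin p → ℝ) (hlam : ∀ i, 0 ≤ lam i)
    (hsorted : ∀ i j : Fin p, i ≤ j → lam i ≤ lam j)
    (γstar : ℝ → ℝ)
    (hγ : ∀ ρ : ℝ, 0 < ρ →
      0 < γstar ρ ∧
      (ρ ^ 2 - (∑ i, lam i) / 2) * γstar ρ - p
        + (∑ i, Real.sqrt ((lam i) ^ 2 * (γstar ρ) ^ 2 + 4 * lam i * γstar ρ)) / 2 = 0) :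
    (∀ ρ : ℝ, 0 < ρ → ∀ i j : Fin p, i ≤ j →
      shrunkEig (lam j) (γstar ρ) ≤ shrunkEig (lam i) (γstar ρ)) ∧
    (∀ ρ : ℝ, 0 < ρ → ∀ i : Fin p, 0 < shrunkEig (lam i) (γstar ρ)) ∧
    AntitoneOn
      (fun ρ => shrunkEig (lam ⟨0, hp⟩) (γstar ρ)
        / shrunkEig (lam ⟨p - 1, Nat.sub_lt hp Nat.one_pos⟩) (γstar ρ))
      (Set.Ioi 0) ∧
    Filter.Tendsto
      (fun ρ => shrunkEig (lam ⟨0, hp⟩) (γstar ρ)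
        / shrunkEig (lam ⟨p - 1, Nat.sub_lt hp Nat.one_pos⟩) (γstar ρ))
      Filter.atTop (nhds 1) := by
  have hroot (ρ : ℝ) (hρ : 0 < ρ) := sq_mul_sq_eq_sum_shrunkEig (hγ ρ hρ).2
  have hanti : AntitoneOn γstar (Set.Ioi 0) := by
    intro ρ hρ ρ' hρ' hle
    rw [Set.mem_Ioi] at hρ hρ'
    by_contra! hlt
    have h0 := (hγ ρ hρ).1
    have h0' := (hγ ρ' hρ').1
    have hsum : γstar ρ * ∑ i, shrunkEig (lam i) (γstar ρ') ≤
        γstar ρ' * ∑ i, shrunkEig (lam i) (γstar ρ) := by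
      rw [Finset.mul_sum, Finset.mul_sum]
      exact Finset.sum_le_sum fun i _ => mul_shrunkEig_le_mul_shrunkEig (hlam i) h0.le hlt.le
    rw [← hroot ρ hρ, ← hroot ρ' hρ'] at hsum
    have hlt' : γstar ρ * γstar ρ' * (ρ ^ 2 * γstar ρ) <
        γstar ρ * γstar ρ' * (ρ' ^ 2 * γstar ρ') :=
      mul_lt_mul_of_pos_left (mul_lt_mul' (by gcongr) hlt h0.le (by positivity)) (by positivity)
    linarith
  have hle (ρ : ℝ) (hρ : 0 < ρ) : γstar ρ ≤ p / ρ ^ 2 := by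
    have h0 := (hγ ρ hρ).1
    have hsum : ∑ i, shrunkEig (lam i) (γstar ρ) ≤ ∑ _i : Fin p, γstar ρ :=
      Finset.sum_le_sum fun i _ => by
        simpa [shrunkEig] using shrunkEig_le_shrunkEig le_rfl (hlam i) h0.le
    rw [← hroot ρ hρ, Finset.sum_const, Finset.card_univ, Fintype.card_fin, nsmul_eq_mul] at hsum
    rw [le_div_iff₀ (by positivity)]
    exact le_of_mul_le_mul_right (by linarith) h0
  have hlim : Filter.Tendsto γstar Filter.atTop (nhds 0) := by
    refine squeeze_zero' ?_ ?_
      (Filter.Tendsto.const_div_atTop (Filter.tendsto_pow_atTop two_ne_zero) (p : ℝ))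
    · filter_upwards [Filter.eventually_gt_atTop 0] with ρ hρ using (hγ ρ hρ).1.le
    · filter_upwards [Filter.eventually_gt_atTop 0] with ρ hρ using hle ρ hρ
  refine ⟨fun ρ hρ i j hij => shrunkEig_le_shrunkEig (hlam i) (hsorted i j hij) (hγ ρ hρ).1.le,
    fun ρ hρ i => shrunkEig_pos (hlam i) (hγ ρ hρ).1, ?_, ?_⟩
  · intro ρ hρ ρ' hρ' hρρ
    dsimp only
    rw [shrunkEig_div_shrunkEig (hlam _) (hlam _) (hγ ρ hρ).1,
      shrunkEig_div_shrunkEig (hlam _) (hlam _) (hγ ρ' hρ').1, Real.exp_le_exp]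
    refine mul_le_mul_of_nonneg_left ?_ zero_le_two
    refine monotone_arsinh_mul_sub_arsinh_mul (by positivity) ?_
      (Real.sqrt_le_sqrt (hanti hρ hρ' hρρ))
    have := Real.sqrt_le_sqrt (hsorted ⟨0, hp⟩ ⟨p - 1, Nat.sub_lt hp Nat.one_pos⟩
      (Fin.mk_le_mk.2 (Nat.zero_le _)))
    linarith
  · have hcont (a b : ℝ) : Continuous fun g : ℝ =>
        Real.exp (2 * (Real.arsinh (√b / 2 * √g) - Real.arsinh (√a / 2 * √g))) := by
      have hk (k : ℝ) : Continuous fun g : ℝ => Real.arsinh (k * √g) :=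
        Real.continuous_arsinh.comp (continuous_const.mul Real.continuous_sqrt)
      exact Real.continuous_exp.comp (continuous_const.mul ((hk _).sub (hk _)))
    have h := ((hcont (lam ⟨0, hp⟩) (lam ⟨p - 1, Nat.sub_lt hp Nat.one_pos⟩)).tendsto 0).comp hlim
    simp only [Real.sqrt_zero, mul_zero, Real.arsinh_zero, sub_zero, Real.exp_zero] at h
    refine h.congr' ?_
    filter_upwards [Filter.eventually_gt_atTop 0] with ρ hρ
    exact (shrunkEig_div_shrunkEig (hlam _) (hlam _) (hγ ρ hρ).1).symm
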